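/- arXiv:2106.15746 — 11 statements merged into one kernel-verified Lean document; each statement's English description precedes it below -/
import Mathlib

section
/- Let S be a t-conorm, N a strong fuzzy negation, and T a t-norm. Then the (S,N,T)-implication satisfies the consequent boundary property (CB): y ≤ I_{S,N,T}(x,y) for all x,y ∈ [0,1]. -/
/-- The (S,N,T)-implication: I(x,y) = S(N(T(x,N(y))), N(x)). -/
def SNTimp (S T : unitInterval → unitInterval → unitInterval)
    (N : unitInterval → unitInterval) : unitInterval → unitInterval → unitInterval :=
  fun x y => S (N (T x (N y))) (N x)

theorem snt_cb_of_strong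
    (S T : unitInterval → unitInterval → unitInterval) (N : unitInterval → unitInterval)
    (hS_comm : ∀ x y : unitInterval, S x y = S y x)
    (hS_assoc : ∀ x y z : unitInterval, S x (S y z) = S (S x y) z)
    (hS_mono : ∀ x₁ x₂ y₁ y₂ : unitInterval, x₁ ≤ x₂ → y₁ ≤ y₂ → S x₁ y₁ ≤ S x₂ y₂)
    (hS_zero : ∀ x : unitInterval, S x 0 = x)
    (hN_anti : ∀ x y : unitInterval, x ≤ y → N y ≤ N x)
    (hN_zero : N 0 = 1) (hN_one : N 1 = 0)
    (hN_strong : ∀ x : unitInterval, N (N x) = x)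
    (hT_comm : ∀ x y : unitInterval, T x y = T y x)
    (hT_assoc : ∀ x y z : unitInterval, T x (T y z) = T (T x y) z)
    (hT_mono : ∀ x₁ x₂ y₁ y₂ : unitInterval, x₁ ≤ x₂ → y₁ ≤ y₂ → T x₁ y₁ ≤ T x₂ y₂)
    (hT_one : ∀ x : unitInterval, T x 1 = x)
    : ∀ x y : unitInterval, y ≤ SNTimp S T N x y := by
  intro x y
  have h1 : T x (N y) ≤ N y := by
    have h := hT_mono x 1 (N y) (N y) unitInterval.le_one' le_rfl
    rwa [hT_comm 1, hT_one] at h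
  have h2 : y ≤ N (T x (N y)) := by
    have h := hN_anti _ _ h1
    rwa [hN_strong] at h
  have h3 : S (N (T x (N y))) 0 ≤ S (N (T x (N y))) (N x) :=
    hS_mono _ _ _ _ le_rfl unitInterval.nonneg'
  rw [hS_zero] at h3
  exact h2.trans h3
end

section
/- Let S be a t-conorm, N a strong fuzzy negation, and T a t-norm. Then the (S,N,T)-implication satisfies the weak iterative boundary property (SIB): I_{S,N,T}(x,y) ≤ I_{S,N,T}(x, I_{S,N,T}(x,y)) for all x,y ∈ [0,1]. -/
theorem snt_sib_of_strong
    (S T : unitInterval → unitInterval → unitInterval) (N : unitInterval → unitInterval)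
    (hS_comm : ∀ x y : unitInterval, S x y = S y x)
    (hS_assoc : ∀ x y z : unitInterval, S x (S y z) = S (S x y) z)
    (hS_mono : ∀ x₁ x₂ y₁ y₂ : unitInterval, x₁ ≤ x₂ → y₁ ≤ y₂ → S x₁ y₁ ≤ S x₂ y₂)
    (hS_zero : ∀ x : unitInterval, S x 0 = x)
    (hN_anti : ∀ x y : unitInterval, x ≤ y → N y ≤ N x)
    (hN_zero : N 0 = 1) (hN_one : N 1 = 0)
    (hN_strong : ∀ x : unitInterval, N (N x) = x)
    (hT_comm : ∀ x y : unitInterval, T x y = T y x)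
    (hT_assoc : ∀ x y z : unitInterval, T x (T y z) = T (T x y) z)
    (hT_mono : ∀ x₁ x₂ y₁ y₂ : unitInterval, x₁ ≤ x₂ → y₁ ≤ y₂ → T x₁ y₁ ≤ T x₂ y₂)
    (hT_one : ∀ x : unitInterval, T x 1 = x)
    : ∀ x y : unitInterval, SNTimp S T N x y ≤ SNTimp S T N x (SNTimp S T N x y) := by
  have key : ∀ x z : unitInterval, z ≤ SNTimp S T N x z := by
    intro x z
    have h1 : T x (N z) ≤ N z := by
      have h := hT_mono x 1 (N z) (N z) unitInterval.le_one' le_rfl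
      rwa [hT_comm 1, hT_one] at h
    have h2 : z ≤ N (T x (N z)) := by
      have h := hN_anti _ _ h1
      rwa [hN_strong] at h
    have h3 := hS_mono (N (T x (N z))) _ 0 (N x) le_rfl unitInterval.nonneg'
    rw [hS_zero] at h3
    exact h2.trans h3
  intro x y
  exact key x _
end

section
/- Let S be a t-conorm, N a crisp fuzzy negation, and T a t-norm. Then the (S,N,T)-implication satisfies the identity principle (IP): I_{S,N,T}(x,x) = 1 for all x ∈ [0,1]. -/
theorem snt_ip_of_crisp
    (S T : unitInterval → unitInterval → unitInterval) (N : unitInterval → unitInterval)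
    (hS_comm : ∀ x y : unitInterval, S x y = S y x)
    (hS_assoc : ∀ x y z : unitInterval, S x (S y z) = S (S x y) z)
    (hS_mono : ∀ x₁ x₂ y₁ y₂ : unitInterval, x₁ ≤ x₂ → y₁ ≤ y₂ → S x₁ y₁ ≤ S x₂ y₂)
    (hS_zero : ∀ x : unitInterval, S x 0 = x)
    (hN_anti : ∀ x y : unitInterval, x ≤ y → N y ≤ N x)
    (hN_zero : N 0 = 1) (hN_one : N 1 = 0)
    (hN_crisp : ∀ x : unitInterval, N x = 0 ∨ N x = 1)
    (hT_comm : ∀ x y : unitInterval, T x y = T y x)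
    (hT_assoc : ∀ x y z : unitInterval, T x (T y z) = T (T x y) z)
    (hT_mono : ∀ x₁ x₂ y₁ y₂ : unitInterval, x₁ ≤ x₂ → y₁ ≤ y₂ → T x₁ y₁ ≤ T x₂ y₂)
    (hT_one : ∀ x : unitInterval, T x 1 = x)
    : ∀ x : unitInterval, SNTimp S T N x x = 1 := by
  intro x
  show S (N (T x (N x))) (N x) = 1
  rcases hN_crisp x with h | h
  · have h0 : T x 0 = 0 := by
      apply le_antisymm _ unitInterval.nonneg'
      calc T x 0 ≤ T 1 0 := hT_mono _ _ _ _ unitInterval.le_one' le_rfl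
        _ = 0 := by rw [hT_comm, hT_one]
    rw [h, h0, hN_zero, hS_zero]
  · rw [h]
    apply le_antisymm unitInterval.le_one'
    calc (1 : unitInterval) = S 0 1 := by rw [hS_comm, hS_zero]
      _ ≤ _ := hS_mono _ _ _ _ unitInterval.nonneg' le_rfl
end

section
/- Let S be a t-conorm, N a crisp fuzzy negation, and T a t-norm. Then the (S,N,T)-implication satisfies the left ordering property (LOP): for all x,y ∈ [0,1], if x ≤ y then I_{S,N,T}(x,y) = 1. -/
theorem snt_lop_of_crisp
    (S T : unitInterval → unitInterval → unitInterval) (N : unitInterval → unitInterval)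
    (hS_comm : ∀ x y : unitInterval, S x y = S y x)
    (hS_assoc : ∀ x y z : unitInterval, S x (S y z) = S (S x y) z)
    (hS_mono : ∀ x₁ x₂ y₁ y₂ : unitInterval, x₁ ≤ x₂ → y₁ ≤ y₂ → S x₁ y₁ ≤ S x₂ y₂)
    (hS_zero : ∀ x : unitInterval, S x 0 = x)
    (hN_anti : ∀ x y : unitInterval, x ≤ y → N y ≤ N x)
    (hN_zero : N 0 = 1) (hN_one : N 1 = 0)
    (hN_crisp : ∀ x : unitInterval, N x = 0 ∨ N x = 1)
    (hT_comm : ∀ x y : unitInterval, T x y = T y x)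
    (hT_assoc : ∀ x y z : unitInterval, T x (T y z) = T (T x y) z)
    (hT_mono : ∀ x₁ x₂ y₁ y₂ : unitInterval, x₁ ≤ x₂ → y₁ ≤ y₂ → T x₁ y₁ ≤ T x₂ y₂)
    (hT_one : ∀ x : unitInterval, T x 1 = x)
    : ∀ x y : unitInterval, x ≤ y → SNTimp S T N x y = 1 := by
  intro x y hxy
  have hS1 : ∀ a, S 1 a = 1 := fun a =>
    le_antisymm unitInterval.le_one' (by
      have h := hS_mono 1 1 0 a le_rfl unitInterval.nonneg'
      rwa [hS_zero] at h)
  unfold SNTimp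
  rcases hN_crisp y with h | h
  · have hT : T x 0 = 0 := le_antisymm (by
      have h := hT_mono x 1 0 0 unitInterval.le_one' le_rfl
      rwa [hT_comm 1 0, hT_one] at h) unitInterval.nonneg'
    rw [h, hT, hN_zero, hS1]
  · have hx : N x = 1 := le_antisymm unitInterval.le_one' (h ▸ hN_anti x y hxy)
    rw [hx, hS_comm, hS1]
end

section
/- Let S be a t-conorm, N a crisp fuzzy negation, and T a t-norm. Then the (S,N,T)-implication satisfies the exchange principle (EP): I_{S,N,T}(x, I_{S,N,T}(y,z)) = I_{S,N,T}(y, I_{S,N,T}(x,z)) for all x,y,z ∈ [0,1]. -/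
theorem snt_ep_of_crisp
    (S T : unitInterval → unitInterval → unitInterval) (N : unitInterval → unitInterval)
    (hS_comm : ∀ x y : unitInterval, S x y = S y x)
    (hS_assoc : ∀ x y z : unitInterval, S x (S y z) = S (S x y) z)
    (hS_mono : ∀ x₁ x₂ y₁ y₂ : unitInterval, x₁ ≤ x₂ → y₁ ≤ y₂ → S x₁ y₁ ≤ S x₂ y₂)
    (hS_zero : ∀ x : unitInterval, S x 0 = x)
    (hN_anti : ∀ x y : unitInterval, x ≤ y → N y ≤ N x)
    (hN_zero : N 0 = 1) (hN_one : N 1 = 0)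
    (hN_crisp : ∀ x : unitInterval, N x = 0 ∨ N x = 1)
    (hT_comm : ∀ x y : unitInterval, T x y = T y x)
    (hT_assoc : ∀ x y z : unitInterval, T x (T y z) = T (T x y) z)
    (hT_mono : ∀ x₁ x₂ y₁ y₂ : unitInterval, x₁ ≤ x₂ → y₁ ≤ y₂ → T x₁ y₁ ≤ T x₂ y₂)
    (hT_one : ∀ x : unitInterval, T x 1 = x)
    : ∀ x y z : unitInterval,
      SNTimp S T N x (SNTimp S T N y z) = SNTimp S T N y (SNTimp S T N x z) := by
  have hS1 : ∀ a, S 1 a = 1 := fun a => le_antisymm unitInterval.le_one' (by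
    have h := hS_mono 1 1 0 a le_rfl unitInterval.nonneg'
    rwa [hS_zero] at h)
  have hT0 : ∀ a, T a 0 = 0 := fun a => le_antisymm (by
    have h := hT_mono 0 0 a 1 le_rfl unitInterval.le_one'
    rwa [hT_one, hT_comm] at h) unitInterval.nonneg'
  have h0 : ∀ x z, N z = 0 → SNTimp S T N x z = 1 := fun x z hz => by
    simp only [SNTimp, hz, hT0, hN_zero, hS1]
  have h1 : ∀ x z, N z = 1 → SNTimp S T N x z = N x := fun x z hz => by
    simp only [SNTimp, hz, hT_one]
    rcases hN_crisp x with h | h <;> simp only [h, hS_zero, hS1]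
  intro x y z
  rcases hN_crisp z with hz | hz
  · rw [h0 y z hz, h0 x z hz, h0 x 1 hN_one, h0 y 1 hN_one]
  · rw [h1 y z hz, h1 x z hz]
    rcases hN_crisp x with hx | hx <;> rcases hN_crisp y with hy | hy <;> rw [hx, hy]
    · rw [h1 x 0 hN_zero, h1 y 0 hN_zero, hx, hy]
    · rw [h0 x 1 hN_one, h1 y 0 hN_zero, hy]
    · rw [h1 x 0 hN_zero, h0 y 1 hN_one, hx]
    · rw [h0 x 1 hN_one, h0 y 1 hN_one]
end

section
/- Let S be a t-conorm, N a crisp fuzzy negation, and T a t-norm. Then the (S,N,T)-implication does not satisfy the right ordering property (ROP): there exist x,y ∈ [0,1] with I_{S,N,T}(x,y) = 1 and x > y. -/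
theorem snt_not_rop_of_crisp
    (S T : unitInterval → unitInterval → unitInterval) (N : unitInterval → unitInterval)
    (hS_comm : ∀ x y : unitInterval, S x y = S y x)
    (hS_assoc : ∀ x y z : unitInterval, S x (S y z) = S (S x y) z)
    (hS_mono : ∀ x₁ x₂ y₁ y₂ : unitInterval, x₁ ≤ x₂ → y₁ ≤ y₂ → S x₁ y₁ ≤ S x₂ y₂)
    (hS_zero : ∀ x : unitInterval, S x 0 = x)
    (hN_anti : ∀ x y : unitInterval, x ≤ y → N y ≤ N x)
    (hN_zero : N 0 = 1) (hN_one : N 1 = 0)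
    (hN_crisp : ∀ x : unitInterval, N x = 0 ∨ N x = 1)
    (hT_comm : ∀ x y : unitInterval, T x y = T y x)
    (hT_assoc : ∀ x y z : unitInterval, T x (T y z) = T (T x y) z)
    (hT_mono : ∀ x₁ x₂ y₁ y₂ : unitInterval, x₁ ≤ x₂ → y₁ ≤ y₂ → T x₁ y₁ ≤ T x₂ y₂)
    (hT_one : ∀ x : unitInterval, T x 1 = x)
    : ∃ x y : unitInterval, SNTimp S T N x y = 1 ∧ y < x := by
  have hS1 : S 1 1 = 1 := by
    apply le_antisymm unitInterval.le_one'
    calc (1 : unitInterval) = S 1 0 := (hS_zero 1).symm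
      _ ≤ S 1 1 := hS_mono _ _ _ _ le_rfl unitInterval.nonneg'
  obtain ⟨h, h0, h1⟩ : ∃ h : unitInterval, 0 < h ∧ h < 1 := exists_between zero_lt_one
  rcases hN_crisp h with hh | hh
  · refine ⟨1, h, ?_, h1⟩
    simp only [SNTimp]
    rw [hh, hT_comm, hT_one, hN_zero, hN_one, hS_zero]
  · refine ⟨h, 0, ?_, h0⟩
    simp only [SNTimp]
    rw [hN_zero, hT_one, hh, hS1]
end

section
/- Let S be a t-conorm, T a t-norm, and for α ∈ (0,1] let N^α be the crisp fuzzy negation defined by N^α(x) = 1 if x < α and N^α(x) = 0 if x ≥ α. Then for all x,y ∈ [0,1], I_{S,N^α,T}(x,y) = 1 if x < α or y ≥ α, and I_{S,N^α,T}(x,y) = 0 otherwise. -/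
theorem snt_with_N_upper_alpha
    (S T : unitInterval → unitInterval → unitInterval) (N : unitInterval → unitInterval) (α : unitInterval)
    (hS_comm : ∀ x y : unitInterval, S x y = S y x)
    (hS_assoc : ∀ x y z : unitInterval, S x (S y z) = S (S x y) z)
    (hS_mono : ∀ x₁ x₂ y₁ y₂ : unitInterval, x₁ ≤ x₂ → y₁ ≤ y₂ → S x₁ y₁ ≤ S x₂ y₂)
    (hS_zero : ∀ x : unitInterval, S x 0 = x)
    (hT_comm : ∀ x y : unitInterval, T x y = T y x)
    (hT_assoc : ∀ x y z : unitInterval, T x (T y z) = T (T x y) z)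
    (hT_mono : ∀ x₁ x₂ y₁ y₂ : unitInterval, x₁ ≤ x₂ → y₁ ≤ y₂ → T x₁ y₁ ≤ T x₂ y₂)
    (hT_one : ∀ x : unitInterval, T x 1 = x)
    (halpha : 0 < α)
    (hN : ∀ x : unitInterval, N x = if x < α then 1 else 0)
    : ∀ x y : unitInterval, SNTimp S T N x y = if x < α ∨ α ≤ y then 1 else 0 := by
  intro x y
  have hS1 : ∀ a : unitInterval, S a 1 = 1 := by
    intro a
    apply le_antisymm unitInterval.le_one'
    have h := hS_mono 0 a 1 1 unitInterval.nonneg' le_rfl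
    rwa [hS_comm 0 1, hS_zero] at h
  have hT0 : T x 0 = 0 := by
    apply le_antisymm _ unitInterval.nonneg'
    have h := hT_mono x 1 0 0 unitInterval.le_one' le_rfl
    rwa [hT_comm 1 0, hT_one] at h
  unfold SNTimp
  by_cases hx : x < α
  · rw [hN x, if_pos hx, hS1, if_pos (Or.inl hx)]
  · rw [hN x, if_neg hx, hS_zero]
    by_cases hy : y < α
    · rw [hN y, if_pos hy, hT_one, hN x, if_neg hx, if_neg]
      exact fun h => h.elim hx (not_le.mpr hy)
    · rw [hN y, if_neg hy, hT0, hN 0, if_pos halpha, if_pos (Or.inr (not_lt.mp hy))]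
end

section
/- Let T be a t-norm, S a positive t-conorm, and N a non-filling fuzzy negation. Then the (S,N,T)-implication satisfies the identity principle (IP), i.e., I_{S,N,T}(x,x) = 1 for all x ∈ [0,1], if and only if the pair (T,N) satisfies the law of contradiction, i.e., T(N(x),x) = 0 for all x ∈ [0,1]. -/
theorem snt_ip_iff_lc
    (S T : unitInterval → unitInterval → unitInterval) (N : unitInterval → unitInterval)
    (hS_comm : ∀ x y : unitInterval, S x y = S y x)
    (hS_assoc : ∀ x y z : unitInterval, S x (S y z) = S (S x y) z)
    (hS_mono : ∀ x₁ x₂ y₁ y₂ : unitInterval, x₁ ≤ x₂ → y₁ ≤ y₂ → S x₁ y₁ ≤ S x₂ y₂)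
    (hS_zero : ∀ x : unitInterval, S x 0 = x)
    (hN_anti : ∀ x y : unitInterval, x ≤ y → N y ≤ N x)
    (hN_zero : N 0 = 1) (hN_one : N 1 = 0)
    (hT_comm : ∀ x y : unitInterval, T x y = T y x)
    (hT_assoc : ∀ x y z : unitInterval, T x (T y z) = T (T x y) z)
    (hT_mono : ∀ x₁ x₂ y₁ y₂ : unitInterval, x₁ ≤ x₂ → y₁ ≤ y₂ → T x₁ y₁ ≤ T x₂ y₂)
    (hT_one : ∀ x : unitInterval, T x 1 = x)
    (hS_pos : ∀ x y : unitInterval, S x y = 1 → x = 1 ∨ y = 1)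
    (hN_nonfilling : ∀ x : unitInterval, N x = 1 ↔ x = 0)
    : (∀ x : unitInterval, SNTimp S T N x x = 1) ↔ (∀ x : unitInterval, T (N x) x = 0) := by
  constructor
  · intro h x
    rcases hS_pos _ _ (h x) with h1 | h1
    · rw [hT_comm]
      exact (hN_nonfilling _).1 h1
    · have hx := (hN_nonfilling _).1 h1
      subst hx
      rw [hN_zero, hT_comm, hT_one]
  · intro h x
    change S (N (T x (N x))) (N x) = 1
    rw [hT_comm, h x, hN_zero]
    apply le_antisymm unitInterval.le_one'
    have h2 := hS_mono 1 1 0 (N x) le_rfl unitInterval.nonneg'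
    rwa [hS_zero] at h2
end

section
/- Let S be a t-conorm, T a t-norm, and N a strong fuzzy negation such that T is N-dual to S, i.e., N(T(x,y)) = S(N(x),N(y)) for all x,y ∈ [0,1]. Then the (S,N,T)-implication satisfies the exchange principle (EP): I_{S,N,T}(x, I_{S,N,T}(y,z)) = I_{S,N,T}(y, I_{S,N,T}(x,z)) for all x,y,z ∈ [0,1]. -/
theorem snt_ep_of_dual
    (S T : unitInterval → unitInterval → unitInterval) (N : unitInterval → unitInterval)
    (hS_comm : ∀ x y : unitInterval, S x y = S y x)
    (hS_assoc : ∀ x y z : unitInterval, S x (S y z) = S (S x y) z)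
    (hS_mono : ∀ x₁ x₂ y₁ y₂ : unitInterval, x₁ ≤ x₂ → y₁ ≤ y₂ → S x₁ y₁ ≤ S x₂ y₂)
    (hS_zero : ∀ x : unitInterval, S x 0 = x)
    (hN_anti : ∀ x y : unitInterval, x ≤ y → N y ≤ N x)
    (hN_zero : N 0 = 1) (hN_one : N 1 = 0)
    (hN_strong : ∀ x : unitInterval, N (N x) = x)
    (hT_comm : ∀ x y : unitInterval, T x y = T y x)
    (hT_assoc : ∀ x y z : unitInterval, T x (T y z) = T (T x y) z)
    (hT_mono : ∀ x₁ x₂ y₁ y₂ : unitInterval, x₁ ≤ x₂ → y₁ ≤ y₂ → T x₁ y₁ ≤ T x₂ y₂)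
    (hT_one : ∀ x : unitInterval, T x 1 = x)
    (hdual : ∀ x y : unitInterval, N (T x y) = S (N x) (N y))
    : ∀ x y z : unitInterval,
      SNTimp S T N x (SNTimp S T N y z) = SNTimp S T N y (SNTimp S T N x z) := by
  intro x y z
  haveI : Std.Commutative S := ⟨hS_comm⟩
  haveI : Std.Associative S := ⟨fun a b c => (hS_assoc a b c).symm⟩
  simp only [SNTimp, hdual, hN_strong]
  ac_rfl
end

section
/- Let N be a strong fuzzy negation, S(x,y) = max(x,y), and T(x,y) = min(x,y). Then the (S,N,T)-implication satisfies the left contrapositive symmetry property (L-CP) with respect to N: I_{S,N,T}(N(x),y) = I_{S,N,T}(N(y),x) for all x,y ∈ [0,1]. -/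
theorem snt_lcp_max_min
    (N : unitInterval → unitInterval)
    (hN_anti : ∀ x y : unitInterval, x ≤ y → N y ≤ N x)
    (hN_zero : N 0 = 1) (hN_one : N 1 = 0)
    (hN_strong : ∀ x : unitInterval, N (N x) = x)
    : ∀ x y : unitInterval,
      SNTimp (fun a b => max a b) (fun a b => min a b) N (N x) y
        = SNTimp (fun a b => max a b) (fun a b => min a b) N (N y) x := by
  intro x y
  have key : ∀ a b : unitInterval, max (N (min (N a) (N b))) (N (N a)) = max a b := by
    intro a b
    rw [hN_strong]
    rcases le_total a b with h | h
    · rw [min_eq_right (hN_anti _ _ h), hN_strong, max_comm]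
    · rw [min_eq_left (hN_anti _ _ h), hN_strong, max_self, max_eq_left h]
  change max (N (min (N x) (N y))) (N (N x)) = max (N (min (N y) (N x))) (N (N y))
  rw [key, key, max_comm]
end

section
/- Let N be a strong fuzzy negation, S(x,y) = max(x,y), and T(x,y) = min(x,y). Then the function S' : [0,1]² → [0,1] defined by S'(x,y) = I_{S,N,T}(N(x),y) is a t-conorm, i.e., S' is commutative, associative, nondecreasing in each argument, and satisfies S'(x,0) = x for all x ∈ [0,1]. -/
theorem snt_tconorm_from_implication
    (N : unitInterval → unitInterval)
    (hN_anti : ∀ x y : unitInterval, x ≤ y → N y ≤ N x)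
    (hN_zero : N 0 = 1) (hN_one : N 1 = 0)
    (hN_strong : ∀ x : unitInterval, N (N x) = x)
    : (∀ x y : unitInterval,
        SNTimp (fun a b => max a b) (fun a b => min a b) N (N x) y
          = SNTimp (fun a b => max a b) (fun a b => min a b) N (N y) x) ∧
      (∀ x y z : unitInterval,
        SNTimp (fun a b => max a b) (fun a b => min a b) N (N x)
            (SNTimp (fun a b => max a b) (fun a b => min a b) N (N y) z)
          = SNTimp (fun a b => max a b) (fun a b => min a b) N
              (N (SNTimp (fun a b => max a b) (fun a b => min a b) N (N x) y)) z) ∧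
      (∀ x₁ x₂ y₁ y₂ : unitInterval, x₁ ≤ x₂ → y₁ ≤ y₂ →
        SNTimp (fun a b => max a b) (fun a b => min a b) N (N x₁) y₁
          ≤ SNTimp (fun a b => max a b) (fun a b => min a b) N (N x₂) y₂) ∧
      (∀ x : unitInterval,
        SNTimp (fun a b => max a b) (fun a b => min a b) N (N x) 0 = x) := by
  have key : ∀ x y : unitInterval,
      SNTimp (fun a b => max a b) (fun a b => min a b) N (N x) y = max x y := by
    intro x y
    have hanti : Antitone N := fun a b h => hN_anti a b h
    simp only [SNTimp]
    rw [hanti.map_min, hN_strong, hN_strong]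
    exact max_eq_left (le_max_left x y)
  refine ⟨fun x y => ?_, fun x y z => ?_, fun x₁ x₂ y₁ y₂ hx hy => ?_, fun x => ?_⟩
  · rw [key, key, max_comm]
  · rw [key, key, key, key, max_assoc]
  · rw [key, key]
    exact max_le_max hx hy
  · rw [key]
    exact max_eq_left unitInterval.nonneg'
end
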